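/- arXiv:2503.20920 — 6 statements merged into one kernel-verified Lean document; each statement's English description precedes it below -/
import Mathlib

section
/- Let H be a definite Bethe–Salpeter matrix of size 2n×2n. Then there exist matrices X₁, X₂ ∈ ℂ^{n×n} and positive real numbers λ₁, …, λₙ such that, setting Λ₊ = diag(λ₁, …, λₙ), X = [[X₁, conj(X₂)],[X₂, conj(X₁)]] and Y = [[X₁, −conj(X₂)],[−X₂, conj(X₁)]], one has H·X = X·[[Λ₊, 0],[0, −Λ₊]], Y*·H = [[Λ₊, 0],[0, −Λ₊]]·Y*, and Y*·X = I_{2n}. -/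
open Matrix
open scoped ComplexOrder

/-- Entrywise complex conjugation of a matrix. -/
def mconj {m l : Type*} (M : Matrix m l ℂ) : Matrix m l ℂ := M.map (starRingEnd ℂ)

theorem mconj_diagonal_ofReal {p : Type*} [DecidableEq p] (d : p → ℝ) :
    mconj (diagonal (fun i => (d i : ℂ))) = diagonal (fun i => (d i : ℂ)) := by
  ext i j
  by_cases h : i = j <;> simp [mconj, h]

/-- The antilinear involution `[Z₁; Z₂] ↦ [conj Z₂; conj Z₁]` on block columns. -/
def swapConj {ι p : Type*} (Z : Matrix (ι ⊕ ι) p ℂ) : Matrix (ι ⊕ ι) p ℂ :=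
  (mconj Z).submatrix Sum.swap id

theorem swapConj_mul {ι p : Type*} [Fintype p] (Z : Matrix (ι ⊕ ι) p ℂ) (D : Matrix p p ℂ) :
    swapConj (Z * D) = swapConj Z * mconj D := by
  ext i j
  simp [swapConj, mconj, mul_apply]

theorem swapConj_mul_left {ι p : Type*} [Fintype ι] (A : Matrix (ι ⊕ ι) (ι ⊕ ι) ℂ)
    (Z : Matrix (ι ⊕ ι) p ℂ) :
    swapConj (A * Z) = (mconj A).submatrix Sum.swap Sum.swap * swapConj Z := by
  ext i j
  simp [swapConj, mconj, mul_apply, add_comm]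

theorem conjTranspose_swapConj_mul_swapConj {ι p : Type*} [Fintype ι]
    (Z W : Matrix (ι ⊕ ι) p ℂ) :
    (swapConj Z)ᴴ * swapConj W = mconj (Zᴴ * W) := by
  ext i j
  simp [swapConj, mconj, mul_apply, add_comm]

/-- The signature matrix `diag(I, -I)`. -/
def signature (ι : Type*) [DecidableEq ι] : Matrix (ι ⊕ ι) (ι ⊕ ι) ℂ :=
  diagonal (Sum.elim (fun _ => 1) (fun _ => -1))

theorem signature_isHermitian {ι : Type*} [DecidableEq ι] : (signature ι).IsHermitian := by
  rw [IsHermitian, signature, diagonal_conjTranspose]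
  congr 1
  ext (i | i) <;> simp

theorem signature_mul_self {ι : Type*} [Fintype ι] [DecidableEq ι] :
    signature ι * signature ι = 1 := by
  rw [signature, diagonal_mul_diagonal, ← diagonal_one]
  congr 1
  ext (i | i) <;> simp

theorem swapConj_signature_mul {ι p : Type*} [Fintype ι] [DecidableEq ι]
    (Z : Matrix (ι ⊕ ι) p ℂ) :
    swapConj (signature ι * Z) = -(signature ι * swapConj Z) := by
  ext (i | i) j <;> simp [swapConj, mconj, signature, diagonal_mul]

section BetheSalpeter

variable {ι p : Type*} [Fintype ι] [DecidableEq ι] [Fintype p] [DecidableEq p]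

/-- Simultaneous reduction of a Hermitian matrix `S` and a positive definite matrix `A` by
congruence. -/
theorem exists_generalized_eigenbasis {A S : Matrix ι ι ℂ} (hA : A.PosDef) (hS : S.IsHermitian) :
    ∃ (V : Matrix ι ι ℂ) (μ : ι → ℝ),
      Vᴴ * A * V = 1 ∧ S * V = A * V * diagonal (fun i => (μ i : ℂ)) := by
  obtain ⟨B, hB, rfl⟩ : ∃ B : Matrix ι ι ℂ, IsUnit B ∧ A = Bᴴ * B := by
    open scoped MatrixOrder Matrix.Norms.L2Operator in
    exact CStarAlgebra.isStrictlyPositive_iff_eq_star_mul_self.mp hA.isStrictlyPositive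
  rw [Matrix.isUnit_iff_isUnit_det] at hB
  have hT : ((B⁻¹)ᴴ * S * B⁻¹).IsHermitian := isHermitian_conjTranspose_mul_mul _ hS
  set U : Matrix ι ι ℂ := hT.eigenvectorUnitary.1 with hU
  have hUU : Uᴴ * U = 1 := Unitary.coe_star_mul_self hT.eigenvectorUnitary
  have hTU : (B⁻¹)ᴴ * S * B⁻¹ * U = U * diagonal (fun i => (hT.eigenvalues i : ℂ)) := by
    conv_lhs => rw [hT.spectral_theorem, Unitary.conjStarAlgAut_apply, ← hU]
    rw [Matrix.mul_assoc]
    change _ * (Uᴴ * U) = _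
    rw [hUU, Matrix.mul_one]
    rfl
  have hBB : B * B⁻¹ = 1 := Matrix.mul_nonsing_inv _ hB
  have hBB' : Bᴴ * (B⁻¹)ᴴ = 1 := by
    rw [← conjTranspose_mul, Matrix.nonsing_inv_mul _ hB, conjTranspose_one]
  have hBU : B * (B⁻¹ * U) = U := by rw [← Matrix.mul_assoc, hBB, Matrix.one_mul]
  refine ⟨B⁻¹ * U, hT.eigenvalues, ?_, ?_⟩
  · calc (B⁻¹ * U)ᴴ * (Bᴴ * B) * (B⁻¹ * U)
        = (B * (B⁻¹ * U))ᴴ * (B * (B⁻¹ * U)) := by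
          simp only [conjTranspose_mul, Matrix.mul_assoc]
      _ = 1 := by rw [hBU, hUU]
  · calc S * (B⁻¹ * U) = Bᴴ * (B⁻¹)ᴴ * (S * (B⁻¹ * U)) := by rw [hBB', Matrix.one_mul]
      _ = Bᴴ * ((B⁻¹)ᴴ * S * B⁻¹ * U) := by simp only [Matrix.mul_assoc]
      _ = Bᴴ * (B * (B⁻¹ * U) * diagonal (fun i => (hT.eigenvalues i : ℂ))) := by rw [hTU, hBU]
      _ = _ := by simp only [Matrix.mul_assoc]

/-- A selection of the columns of a generalized eigenbasis. -/
theorem submatrix_generalized_eigenbasis {A S V : Matrix ι ι ℂ} {μ : ι → ℝ}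
    (hV1 : Vᴴ * A * V = 1) (hV : S * V = A * V * diagonal (fun i => (μ i : ℂ)))
    {f : p → ι} (hf : Function.Injective f) :
    S * V.submatrix id f = A * V.submatrix id f * diagonal (fun i => (μ (f i) : ℂ)) ∧
      (V.submatrix id f)ᴴ * A * V.submatrix id f = 1 := by
  constructor
  · ext i j
    have h := congrFun (congrFun hV i) (f j)
    rw [mul_diagonal] at h ⊢
    exact h
  · ext i j
    have h := congrFun (congrFun hV1 (f i)) (f j)
    refine Eq.trans ?_ (h.trans ?_)
    · rfl
    · simp [Matrix.one_apply, hf.eq_iff]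

theorem swapConj_eigen {A : Matrix (ι ⊕ ι) (ι ⊕ ι) ℂ}
    (hσ : (mconj A).submatrix Sum.swap Sum.swap = A) {Z : Matrix (ι ⊕ ι) p ℂ} {m : p → ℝ}
    (hZ : signature ι * Z = A * Z * diagonal (fun i => (m i : ℂ))) :
    signature ι * swapConj Z = -(A * swapConj Z * diagonal (fun i => (m i : ℂ))) := by
  rw [eq_neg_iff_add_eq_zero, ← neg_eq_zero, neg_add, ← swapConj_signature_mul, hZ, swapConj_mul,
    mconj_diagonal_ofReal, swapConj_mul_left, hσ, add_neg_cancel]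

theorem conjTranspose_fromCols_swapConj_mul {A : Matrix (ι ⊕ ι) (ι ⊕ ι) ℂ} (hA : A.IsHermitian)
    (hσ : (mconj A).submatrix Sum.swap Sum.swap = A) {Z : Matrix (ι ⊕ ι) p ℂ} {m : p → ℝ}
    (hm : ∀ i j, m i + m j ≠ 0) (hZ : signature ι * Z = A * Z * diagonal (fun i => (m i : ℂ)))
    (hZ1 : Zᴴ * A * Z = 1) :
    (fromCols Z (swapConj Z))ᴴ * A * fromCols Z (swapConj Z) = 1 := by
  have hcross : Zᴴ * (A * swapConj Z) = 0 := by
    have h1 : Zᴴ * (signature ι * swapConj Z)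
        = -(Zᴴ * (A * swapConj Z) * diagonal (fun i => (m i : ℂ))) := by
      rw [swapConj_eigen hσ hZ, Matrix.mul_neg, Matrix.mul_assoc]
      simp only [Matrix.mul_assoc]
    have h2 : Zᴴ * (signature ι * swapConj Z)
        = diagonal (fun i => (m i : ℂ)) * (Zᴴ * (A * swapConj Z)) := by
      have h := congrArg conjTranspose hZ
      rw [conjTranspose_mul, signature_isHermitian.eq, conjTranspose_mul, conjTranspose_mul,
        hA.eq, diagonal_conjTranspose] at h
      have hd : star (fun i => (m i : ℂ)) = fun i => (m i : ℂ) := by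
        ext i
        simp
      rw [← Matrix.mul_assoc, h, hd]
      simp only [Matrix.mul_assoc]
    ext i j
    have h := congrFun (congrFun (h2.symm.trans h1) i) j
    rw [diagonal_mul, Matrix.neg_apply, mul_diagonal] at h
    have hne : ((m i + m j : ℝ) : ℂ) ≠ 0 := by exact_mod_cast hm i j
    refine (mul_eq_zero.mp ?_).resolve_left hne
    push_cast
    linear_combination h
  have hcross' : (swapConj Z)ᴴ * (A * Z) = 0 := by
    have h := congrArg conjTranspose hcross
    rwa [conjTranspose_mul, conjTranspose_mul, conjTranspose_conjTranspose, hA.eq,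
      conjTranspose_zero, Matrix.mul_assoc] at h
  have hlast : (swapConj Z)ᴴ * (A * swapConj Z) = 1 := by
    have h : A * swapConj Z = swapConj (A * Z) := by rw [swapConj_mul_left, hσ]
    rw [h, conjTranspose_swapConj_mul_swapConj, ← Matrix.mul_assoc, hZ1]
    ext i j
    simp [mconj, Matrix.one_apply, apply_ite]
  rw [Matrix.mul_assoc] at hZ1
  rw [conjTranspose_fromCols_eq_fromRows_conjTranspose, Matrix.mul_assoc, mul_fromCols,
    fromRows_mul_fromCols, hcross, hcross', hlast, hZ1, fromBlocks_one]

theorem card_le_of_generalized_eigenvectors {A : Matrix (ι ⊕ ι) (ι ⊕ ι) ℂ} (hA : A.IsHermitian)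
    (hσ : (mconj A).submatrix Sum.swap Sum.swap = A) {Z : Matrix (ι ⊕ ι) p ℂ} {m : p → ℝ}
    (hm : ∀ i j, m i + m j ≠ 0) (hZ : signature ι * Z = A * Z * diagonal (fun i => (m i : ℂ)))
    (hZ1 : Zᴴ * A * Z = 1) : Fintype.card p ≤ Fintype.card ι := by
  have h := rank_mul_le_left ((fromCols Z (swapConj Z))ᴴ * A) (fromCols Z (swapConj Z))
  rw [conjTranspose_fromCols_swapConj_mul hA hσ hm hZ hZ1, rank_one] at h
  have h' := h.trans (rank_le_card_width _)
  rw [Fintype.card_sum, Fintype.card_sum] at h'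
  omega

/-- Exactly half of the generalized eigenvalues of `(signature, A)` are positive, so that the
corresponding eigenvectors can be indexed by `ι`. -/
theorem exists_positive_generalized_eigenvectors {A : Matrix (ι ⊕ ι) (ι ⊕ ι) ℂ} (hA : A.PosDef)
    (hσ : (mconj A).submatrix Sum.swap Sum.swap = A) :
    ∃ (Z : Matrix (ι ⊕ ι) ι ℂ) (m : ι → ℝ), (∀ i, 0 < m i) ∧
      signature ι * Z = A * Z * diagonal (fun i => (m i : ℂ)) ∧ Zᴴ * A * Z = 1 := by
  obtain ⟨V, μ, hV1, hV⟩ := exists_generalized_eigenbasis hA (signature_isHermitian (ι := ι))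
  have hμ : ∀ i, μ i ≠ 0 := by
    intro i hi
    have hz : ∀ k, V k i = 0 := by
      intro k
      have h := congrFun (congrFun hV k) i
      rw [mul_diagonal, hi, Complex.ofReal_zero, mul_zero, signature, diagonal_mul] at h
      rcases k with k | k <;> simpa using h
    have h := congrFun (congrFun hV1 i) i
    rw [mul_apply, Matrix.one_apply_eq] at h
    simp [hz] at h
  have hpos : Fintype.card {i // 0 < μ i} ≤ Fintype.card ι := by
    obtain ⟨hZ, hZ1⟩ := submatrix_generalized_eigenbasis hV1 hV
      (Subtype.val_injective (p := fun i => 0 < μ i))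
    exact card_le_of_generalized_eigenvectors hA.isHermitian hσ
      (fun i j => (add_pos i.2 j.2).ne') hZ hZ1
  have hneg : Fintype.card {i // ¬ 0 < μ i} ≤ Fintype.card ι := by
    obtain ⟨hZ, hZ1⟩ := submatrix_generalized_eigenbasis hV1 hV
      (Subtype.val_injective (p := fun i => ¬ 0 < μ i))
    exact card_le_of_generalized_eigenvectors hA.isHermitian hσ
      (fun i j => (add_neg (lt_of_le_of_ne (not_lt.mp i.2) (hμ _))
        (lt_of_le_of_ne (not_lt.mp j.2) (hμ _))).ne) hZ hZ1
  have hcard : Fintype.card ι = Fintype.card {i // 0 < μ i} := by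
    have h := Fintype.card_subtype_compl (fun i => 0 < μ i)
    have h' := Fintype.card_subtype_le (fun i => 0 < μ i)
    rw [Fintype.card_sum] at h h'
    omega
  let e := Fintype.equivOfCardEq hcard
  have h := submatrix_generalized_eigenbasis hV1 hV (Subtype.val_injective.comp e.injective)
  exact ⟨V.submatrix id (fun i => (e i).1), fun i => μ (e i).1, fun i => (e i).2, h.1, h.2⟩

theorem exists_signature_eigenbasis {A : Matrix (ι ⊕ ι) (ι ⊕ ι) ℂ} (hA : A.PosDef)
    (hσ : (mconj A).submatrix Sum.swap Sum.swap = A) :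
    ∃ (W : Matrix (ι ⊕ ι) ι ℂ) (lam : ι → ℝ), (∀ i, 0 < lam i) ∧
      signature ι * A * fromCols W (swapConj W) = fromCols W (swapConj W) *
        diagonal (Sum.elim (fun i => (lam i : ℂ)) (fun i => -(lam i : ℂ))) ∧
      (fromCols W (swapConj W))ᴴ * signature ι * fromCols W (swapConj W) = signature ι := by
  obtain ⟨Z, m, hm, hZ, hZ1⟩ := exists_positive_generalized_eigenvectors hA hσ
  have hG := conjTranspose_fromCols_swapConj_mul hA.isHermitian hσ
    (fun i j => (add_pos (hm i) (hm j)).ne') hZ hZ1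
  set X := fromCols Z (swapConj Z) with hX
  let N : Matrix (ι ⊕ ι) (ι ⊕ ι) ℂ :=
    diagonal (Sum.elim (fun i => (m i : ℂ)) (fun i => -(m i : ℂ)))
  let L : Matrix (ι ⊕ ι) (ι ⊕ ι) ℂ :=
    diagonal (Sum.elim (fun i => (((m i)⁻¹ : ℝ) : ℂ)) (fun i => -(((m i)⁻¹ : ℝ) : ℂ)))
  let d : ι → ℝ := fun i => (√(m i))⁻¹
  let E : Matrix (ι ⊕ ι) (ι ⊕ ι) ℂ :=
    diagonal (Sum.elim (fun i => (d i : ℂ)) (fun i => (d i : ℂ)))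
  have hm' : ∀ i, (m i : ℂ) ≠ 0 := fun i => by exact_mod_cast (hm i).ne'
  have hdmd : ∀ i, (d i : ℂ) * (m i * d i) = 1 := by
    intro i
    have hs : √(m i) ≠ 0 := (Real.sqrt_pos.mpr (hm i)).ne'
    have h : d i * (m i * d i) = 1 := by
      simp only [d]
      nth_rewrite 2 [← Real.mul_self_sqrt (hm i).le]
      field_simp
    exact_mod_cast h
  have hSX : signature ι * X = A * X * N := by
    simp only [hX, N, mul_fromCols, hZ, swapConj_eigen hσ hZ]
    ext i (j | j) <;> simp [mul_diagonal]
  have hXE : fromCols (Z * diagonal (fun i => (d i : ℂ)))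
      (swapConj (Z * diagonal (fun i => (d i : ℂ)))) = X * E := by
    rw [swapConj_mul, mconj_diagonal_ofReal]
    ext i (j | j) <;> simp [hX, E, mul_diagonal]
  have hNL : N * L = 1 := by
    simp only [N, L, diagonal_mul_diagonal, ← diagonal_one]
    congr 1
    ext (i | i) <;> simp [hm' i]
  have hEL : E * L = L * E := by
    simp only [E, L, diagonal_mul_diagonal]
    congr 1
    ext i
    ring
  have hEH : Eᴴ = E := by
    simp only [E, diagonal_conjTranspose]
    congr 1
    ext (i | i) <;> simp
  have hENE : E * (N * E) = signature ι := by
    simp only [E, N, signature, diagonal_mul_diagonal]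
    congr 1
    ext (i | i) <;> simp [hdmd i]
  have hAX : A * X = signature ι * X * L := by
    rw [hSX, Matrix.mul_assoc, hNL, Matrix.mul_one]
  refine ⟨Z * diagonal (fun i => (d i : ℂ)), fun i => (m i)⁻¹, fun i => inv_pos.mpr (hm i), ?_, ?_⟩
  · rw [hXE]
    change signature ι * A * (X * E) = X * E * L
    calc signature ι * A * (X * E) = signature ι * (A * X) * E := by simp only [Matrix.mul_assoc]
      _ = signature ι * signature ι * X * (L * E) := by rw [hAX]; simp only [Matrix.mul_assoc]
      _ = X * E * L := by rw [signature_mul_self, Matrix.one_mul, ← hEL, Matrix.mul_assoc]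
  · rw [hXE]
    calc (X * E)ᴴ * signature ι * (X * E) = E * (Xᴴ * (signature ι * X) * E) := by
          rw [conjTranspose_mul, hEH]
          simp only [Matrix.mul_assoc]
      _ = E * (Xᴴ * A * X * (N * E)) := by rw [hSX]; simp only [Matrix.mul_assoc]
      _ = signature ι := by rw [hG, Matrix.one_mul, hENE]

end BetheSalpeter

/-- Shao et al.: eigendecomposition of a definite Bethe–Salpeter matrix
`H = [[R, C],[−conj C, −conj R]]` with `Ĥ = [[R, C],[conj C, conj R]]` positive definite. -/
theorem bse_eigendecomposition (n : ℕ) (R C : Matrix (Fin n) (Fin n) ℂ)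
    (hR : Rᴴ = R) (hC : Cᵀ = C)
    (hdef : (Matrix.fromBlocks R C (mconj C) (mconj R)).PosDef) :
    ∃ (X₁ X₂ : Matrix (Fin n) (Fin n) ℂ) (lam : Fin n → ℝ),
      (∀ i, 0 < lam i) ∧
      (let H : Matrix (Fin n ⊕ Fin n) (Fin n ⊕ Fin n) ℂ :=
        Matrix.fromBlocks R C (-(mconj C)) (-(mconj R))
      let Λ : Matrix (Fin n) (Fin n) ℂ := Matrix.diagonal (fun i => (lam i : ℂ))
      let Dm : Matrix (Fin n ⊕ Fin n) (Fin n ⊕ Fin n) ℂ := Matrix.fromBlocks Λ 0 0 (-Λ)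
      let X : Matrix (Fin n ⊕ Fin n) (Fin n ⊕ Fin n) ℂ :=
        Matrix.fromBlocks X₁ (mconj X₂) X₂ (mconj X₁)
      let Y : Matrix (Fin n ⊕ Fin n) (Fin n ⊕ Fin n) ℂ :=
        Matrix.fromBlocks X₁ (-(mconj X₂)) (-X₂) (mconj X₁)
      H * X = X * Dm ∧ Yᴴ * H = Dm * Yᴴ ∧ Yᴴ * X = 1) := by
  have hσ : (mconj (fromBlocks R C (mconj C) (mconj R))).submatrix Sum.swap Sum.swap
      = fromBlocks R C (mconj C) (mconj R) := by
    ext (i | i) (j | j) <;> simp [mconj]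
  obtain ⟨W, lam, hlam, hHX, hXSX⟩ := exists_signature_eigenbasis hdef hσ
  refine ⟨W.toRows₁, W.toRows₂, lam, hlam, ?_⟩
  intro H Λ Dm X Y
  have hX : fromCols W (swapConj W) = X := by
    ext (i | i) (j | j) <;> simp [X, swapConj, mconj]
  have hH : signature (Fin n) * fromBlocks R C (mconj C) (mconj R) = H := by
    ext (i | i) (j | j) <;> simp [H, signature, diagonal_mul]
  have hD : diagonal (Sum.elim (fun i => (lam i : ℂ)) (fun i => -(lam i : ℂ))) = Dm := by
    simp only [Dm, Λ, diagonal_neg, fromBlocks_diagonal]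
  have hY : Y = signature (Fin n) * X * signature (Fin n) := by
    ext (i | i) (j | j) <;> simp [X, Y, signature, diagonal_mul, mul_diagonal]
  rw [hX, hH, hD] at hHX
  rw [hX] at hXSX
  have hYX : Yᴴ * X = 1 := by
    rw [hY, conjTranspose_mul, conjTranspose_mul, signature_isHermitian.eq, Matrix.mul_assoc,
      hXSX, signature_mul_self]
  have hXY : X * Yᴴ = 1 := mul_eq_one_comm.mp hYX
  refine ⟨hHX, ?_, hYX⟩
  calc Yᴴ * H = Yᴴ * (H * X) * Yᴴ := by
        rw [Matrix.mul_assoc, Matrix.mul_assoc H, hXY, Matrix.mul_one]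
    _ = Dm * Yᴴ := by rw [hHX, ← Matrix.mul_assoc, hYX, Matrix.one_mul]
end

section
/- Let H ∈ ℂ^{2n×2n} be a Bethe–Salpeter matrix, let U, V ∈ ℂ^{n×k}, u ∈ ℂⁿ, T ∈ ℂ^{k×k} and β ∈ ℂ. If the Lanczos-type relation H·[[U, V],[conj(U), −conj(V)]] = [[U, V],[conj(U), −conj(V)]]·[[0, T],[I_k, 0]] + β·[u; conj(u)]·e_{2k}* holds (e_{2k} the last standard basis vector of ℂ^{2k}), then H²·[U; conj(U)] = [U; conj(U)]·T + β·[u; conj(u)]·e_k*, where e_k is the last standard basis vector of ℂ^k. -/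
open Matrix

/-- If the Lanczos-type relation
`H·[[U, V],[conj U, −conj V]] = [[U, V],[conj U, −conj V]]·[[0, T],[I, 0]] + β·[u; conj u]·e_{2k}*`
holds for a Bethe–Salpeter matrix `H`, then
`H²·[U; conj U] = [U; conj U]·T + β·[u; conj u]·e_k*`. -/
theorem lanczos_squared_relation (n k : ℕ) (R C : Matrix (Fin n) (Fin n) ℂ)
    (hR : Rᴴ = R) (hC : Cᵀ = C)
    (U V : Matrix (Fin n) (Fin (k + 1)) ℂ) (T : Matrix (Fin (k + 1)) (Fin (k + 1)) ℂ)
    (u : Fin n → ℂ) (β : ℂ)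
    (H : Matrix (Fin n ⊕ Fin n) (Fin n ⊕ Fin n) ℂ)
    (hH : H = Matrix.fromBlocks R C (-(mconj C)) (-(mconj R)))
    (hrel : H * Matrix.fromBlocks U V (mconj U) (-(mconj V)) =
      Matrix.fromBlocks U V (mconj U) (-(mconj V)) *
        Matrix.fromBlocks 0 T 1 0 +
      β • Matrix.vecMulVec (Sum.elim u (star u))
        (Sum.elim (0 : Fin (k + 1) → ℂ) (Pi.single (Fin.last k) 1))) :
    H * H * Matrix.fromRows U (mconj U) =
      Matrix.fromRows U (mconj U) * T +
      β • Matrix.vecMulVec (Sum.elim u (star u)) (Pi.single (Fin.last k) 1) := by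
  have hvec : β • Matrix.vecMulVec (Sum.elim u (star u))
        (Sum.elim (0 : Fin (k + 1) → ℂ) (Pi.single (Fin.last k) 1)) =
      Matrix.fromCols 0
        (β • Matrix.vecMulVec (Sum.elim u (star u)) (Pi.single (Fin.last k) 1)) := by
    ext i (j | j) <;>
      simp only [Matrix.smul_apply, Matrix.vecMulVec_apply, Matrix.fromCols_apply_inl,
        Matrix.fromCols_apply_inr, Sum.elim_inl, Sum.elim_inr, Pi.zero_apply, Matrix.zero_apply,
        mul_zero, smul_zero]
  have hadd (A B A' B' : Matrix (Fin n ⊕ Fin n) (Fin (k + 1)) ℂ) :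
      Matrix.fromCols A B + Matrix.fromCols A' B' = Matrix.fromCols (A + A') (B + B') := by
    ext i (j | j) <;> simp
  have hprod : Matrix.fromBlocks U V (mconj U) (-(mconj V)) * Matrix.fromBlocks 0 T 1 0 =
      Matrix.fromCols (Matrix.fromRows V (-(mconj V))) (Matrix.fromRows U (mconj U) * T) := by
    refine (Matrix.fromBlocks_multiply U V (mconj U) (-(mconj V)) 0 T 1 0).trans ?_
    simp [← Matrix.fromCols_fromRows_eq_fromBlocks, Matrix.fromRows_mul]
  rw [hprod, hvec, hadd, ← Matrix.fromCols_fromRows_eq_fromBlocks, Matrix.mul_fromCols,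
    Matrix.fromCols_ext_iff, add_zero] at hrel
  rw [Matrix.mul_assoc, hrel.1, hrel.2]
end

section
/- Let R, C ∈ ℂ^{n×n} with R = R* and C = Cᵀ, let S = [[Iₙ, 0],[0, −Iₙ]], let M', N' ∈ ℂ^{n×j} and ũ ∈ ℂⁿ. Then [[M', N'],[−conj(M'), conj(N')]]*·S·[ũ; conj(ũ)] = [c; d] with c = 2·Re(M'*·ũ) and d = 2·i·Im(N'*·ũ), where Re and Im are taken entrywise. In particular, the reorthogonalization coefficients in Grüning's Lanczos method are c = 2·Re(M'*·ũ) and d = 2·i·Im(N'*·ũ). -/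
open Matrix

/-- Conjugating both factors conjugates the matrix-vector product `Mᴴ *ᵥ u`. -/
theorem conjTranspose_mconj_mulVec_star {m l : Type*} [Fintype m] (M : Matrix m l ℂ)
    (u : m → ℂ) : (mconj M)ᴴ *ᵥ star u = star (Mᴴ *ᵥ u) := by
  ext i
  simp [mconj, Matrix.mulVec, dotProduct]

/-- The reorthogonalization coefficients in Grüning's Lanczos method:
`[[M', N'],[−conj M', conj N']]*·S·[ũ; conj ũ] = [c; d]` with `c = 2·Re(M'*·ũ)` and
`d = 2·i·Im(N'*·ũ)` (entrywise, embedded into `ℂ`). -/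
theorem gruning_reorthogonalization_coefficients (n j : ℕ)
    (M' N' : Matrix (Fin n) (Fin j) ℂ) (u : Fin n → ℂ) :
    let S : Matrix (Fin n ⊕ Fin n) (Fin n ⊕ Fin n) ℂ := Matrix.fromBlocks 1 0 0 (-1)
    ((Matrix.fromBlocks M' N' (-(mconj M')) (mconj N'))ᴴ * S).mulVec
        (Sum.elim u (star u)) =
      Sum.elim (fun i => (2 : ℂ) * (((M'ᴴ.mulVec u) i).re : ℂ))
        (fun i => 2 * Complex.I * (((N'ᴴ.mulVec u) i).im : ℂ)) := by
  intro S
  rw [fromBlocks_conjTranspose, fromBlocks_multiply, fromBlocks_mulVec]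
  congr 1 <;> ext i
  · simpa [conjTranspose_mconj_mulVec_star] using Complex.add_conj ((M'ᴴ *ᵥ u) i)
  · simpa [conjTranspose_mconj_mulVec_star, neg_mulVec, ← sub_eq_add_neg, mul_right_comm]
      using Complex.sub_conj ((N'ᴴ *ᵥ u) i)
end

section
/- Let H ∈ ℂ^{2n×2n} be a Bethe–Salpeter matrix, let U, V ∈ ℂ^{n×k}, u ∈ ℂⁿ, T ∈ ℂ^{k×k}, β ∈ ℂ, and suppose H·[[U, V],[conj(U), −conj(V)]] = [[U, V],[conj(U), −conj(V)]]·[[0, T],[I_k, 0]] + β·[u; conj(u)]·e_{2k}*. Define W = (U + V)/2, Z = (conj(U) − conj(V))/2, A = (I_k + T)/2 and B = (I_k − T)/2. Then H·[[W, conj(Z)],[Z, conj(W)]] = [[W, conj(Z)],[Z, conj(W)]]·[[A, B],[−B, −A]] + (β/2)·[u; conj(u)]·[e_k*, −e_k*], where [e_k*, −e_k*] is the 1×2k row vector with entry 1 in position k and −1 in position 2k. In particular the projected matrix [[A, B],[−B, −A]] of this Lanczos-type relation again has Bethe–Salpeter structure, and both relations provide the same Ritz approximations. -/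
open Matrix

/-- The change of basis `[[I, I], [I, -I]] / 2` passing from the Lanczos basis to the basis
with Bethe–Salpeter structure. -/
noncomputable def basisChange (m : Type*) [DecidableEq m] : Matrix (m ⊕ m) (m ⊕ m) ℂ :=
  ((1 : ℂ) / 2) • Matrix.fromBlocks 1 1 1 (-1)

theorem fromBlocks_mul_basisChange {l m : Type*} [Fintype m] [DecidableEq m]
    (P Q R S : Matrix l m ℂ) :
    Matrix.fromBlocks P Q R S * basisChange m =
      Matrix.fromBlocks (((1 : ℂ) / 2) • (P + Q)) (((1 : ℂ) / 2) • (P - Q))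
        (((1 : ℂ) / 2) • (R + S)) (((1 : ℂ) / 2) • (R - S)) := by
  simp [basisChange, Matrix.fromBlocks_multiply, Matrix.fromBlocks_smul, sub_eq_add_neg]

theorem basisChange_mul_fromBlocks {l m : Type*} [Fintype m] [DecidableEq m]
    (P Q R S : Matrix m l ℂ) :
    basisChange m * Matrix.fromBlocks P Q R S =
      Matrix.fromBlocks (((1 : ℂ) / 2) • (P + R)) (((1 : ℂ) / 2) • (Q + S))
        (((1 : ℂ) / 2) • (P - R)) (((1 : ℂ) / 2) • (Q - S)) := by
  simp [basisChange, Matrix.fromBlocks_multiply, Matrix.fromBlocks_smul, sub_eq_add_neg]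

theorem elim_zero_vecMul_basisChange {m : Type*} [Fintype m] [DecidableEq m] (v : m → ℂ) :
    Sum.elim (0 : m → ℂ) v ᵥ* basisChange m = ((1 : ℂ) / 2) • Sum.elim v (-v) := by
  simp [basisChange, Matrix.vecMul_smul, Matrix.vecMul_fromBlocks, Matrix.vecMul_neg]

theorem mconj_half_smul {m l : Type*} (M : Matrix m l ℂ) :
    mconj (((1 : ℂ) / 2) • M) = ((1 : ℂ) / 2) • mconj M := by
  ext i j
  simp [mconj, Complex.conj_ofNat]

theorem mconj_add {m l : Type*} (M N : Matrix m l ℂ) : mconj (M + N) = mconj M + mconj N := by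
  ext i j
  simp [mconj]

theorem mconj_sub {m l : Type*} (M N : Matrix m l ℂ) : mconj (M - N) = mconj M - mconj N := by
  ext i j
  simp [mconj]

theorem mconj_mconj {m l : Type*} (M : Matrix m l ℂ) : mconj (mconj M) = M := by
  ext i j
  simp [mconj]

/-- Proposition on the projected BSE form: from Shao's Lanczos relation,
with `W = (U + V)/2`, `Z = (conj U − conj V)/2`, `A = (I + T)/2`, `B = (I − T)/2`, one gets
`H·[[W, conj Z],[Z, conj W]] = [[W, conj Z],[Z, conj W]]·[[A, B],[−B, −A]]
 + (β/2)·[u; conj u]·[e_k*, −e_k*]`. -/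
theorem projected_bse_relation (n k : ℕ) (R C : Matrix (Fin n) (Fin n) ℂ)
    (hR : Rᴴ = R) (hC : Cᵀ = C)
    (U V : Matrix (Fin n) (Fin (k + 1)) ℂ) (T : Matrix (Fin (k + 1)) (Fin (k + 1)) ℂ)
    (u : Fin n → ℂ) (β : ℂ)
    (H : Matrix (Fin n ⊕ Fin n) (Fin n ⊕ Fin n) ℂ)
    (hH : H = Matrix.fromBlocks R C (-(mconj C)) (-(mconj R)))
    (hrel : H * Matrix.fromBlocks U V (mconj U) (-(mconj V)) =
      Matrix.fromBlocks U V (mconj U) (-(mconj V)) * Matrix.fromBlocks 0 T 1 0 +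
      β • Matrix.vecMulVec (Sum.elim u (star u))
        (Sum.elim (0 : Fin (k + 1) → ℂ) (Pi.single (Fin.last k) 1)))
    (W Z : Matrix (Fin n) (Fin (k + 1)) ℂ)
    (A B : Matrix (Fin (k + 1)) (Fin (k + 1)) ℂ)
    (hW : W = ((1 : ℂ) / 2) • (U + V))
    (hZ : Z = ((1 : ℂ) / 2) • (mconj U - mconj V))
    (hA : A = ((1 : ℂ) / 2) • (1 + T))
    (hB : B = ((1 : ℂ) / 2) • (1 - T)) :
    H * Matrix.fromBlocks W (mconj Z) Z (mconj W) =
      Matrix.fromBlocks W (mconj Z) Z (mconj W) * Matrix.fromBlocks A B (-B) (-A) +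
      (β / 2) • Matrix.vecMulVec (Sum.elim u (star u))
        (Sum.elim (Pi.single (Fin.last k) 1) (Pi.single (Fin.last k) (-1))) := by
  have hbasis : Matrix.fromBlocks W (mconj Z) Z (mconj W) =
      Matrix.fromBlocks U V (mconj U) (-(mconj V)) * basisChange (Fin (k + 1)) := by
    rw [fromBlocks_mul_basisChange, hW, hZ]
    simp only [mconj_half_smul, mconj_add, mconj_sub, mconj_mconj, sub_neg_eq_add,
      ← sub_eq_add_neg]
  set L : Matrix (Fin (k + 1) ⊕ Fin (k + 1)) (Fin (k + 1) ⊕ Fin (k + 1)) ℂ :=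
    Matrix.fromBlocks 0 T 1 0 with hL
  -- The product on the right of `hrel` elaborates to that of `CStarMatrix`, which unfolds to
  -- the one of `Matrix`.
  have hlanczos : H * Matrix.fromBlocks U V (mconj U) (-(mconj V)) =
      Matrix.fromBlocks U V (mconj U) (-(mconj V)) * L +
      β • Matrix.vecMulVec (Sum.elim u (star u))
        (Sum.elim (0 : Fin (k + 1) → ℂ) (Pi.single (Fin.last k) 1)) := hrel
  have hproj : L * basisChange (Fin (k + 1)) =
      basisChange (Fin (k + 1)) * Matrix.fromBlocks A B (-B) (-A) := by
    rw [hL, fromBlocks_mul_basisChange, basisChange_mul_fromBlocks, hA, hB]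
    congr 1 <;> module
  rw [hbasis, ← Matrix.mul_assoc, hlanczos, Matrix.add_mul, Matrix.mul_assoc, hproj,
    ← Matrix.mul_assoc, Matrix.smul_mul, Matrix.vecMulVec_mul, elim_zero_vecMul_basisChange,
    Matrix.vecMulVec_smul, smul_smul, Pi.single_neg, mul_one_div]
end

section
/- Let D = diag(d₁, …, d_k) with d_i > 0 real, let D^{1/2} = diag(√d₁, …, √d_k), and set G̃ = [[D^{1/2} + I_k, D^{1/2} − I_k],[D^{1/2} − I_k, D^{1/2} + I_k]]. Then (1/2)·[[I_k + D, I_k − D],[−(I_k − D), −(I_k + D)]]·G̃ = G̃·[[D^{1/2}, 0],[0, −D^{1/2}]], and G̃ is invertible; in particular the eigenvalues of (1/2)·[[I_k + D, I_k − D],[−(I_k − D), −(I_k + D)]] are ±√d_i, i = 1, …, k. -/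
open Matrix

/-- If `A` is similar to a diagonal matrix `diagonal v` through an invertible `P`, then its spectrum
is the set of entries of `v`. -/
theorem spectrum_eq_range_of_mul_eq_mul_diagonal {n K : Type*} [Fintype n] [DecidableEq n]
    [Field K] {A P : Matrix n n K} {v : n → K} (hP : IsUnit P.det)
    (h : A * P = P * Matrix.diagonal v) : spectrum K A = Set.range v := by
  obtain ⟨u, rfl⟩ := (Matrix.isUnit_iff_isUnit_det P).2 hP
  have hA : A = u * Matrix.diagonal v * (↑u⁻¹ : Matrix n n K) := by
    rw [← h, mul_assoc, Units.mul_inv, mul_one]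
  rw [hA, spectrum.units_conjugate, spectrum_diagonal]

/-- With `D = diag(d)` (`d_i > 0`), `D^{1/2} = diag(√d)` and
`G̃ = [[D^{1/2} + I, D^{1/2} − I],[D^{1/2} − I, D^{1/2} + I]]`, one has
`(1/2)·[[I + D, I − D],[−(I − D), −(I + D)]]·G̃ = G̃·[[D^{1/2}, 0],[0, −D^{1/2}]]` and
`G̃` is invertible; in particular the eigenvalues of the left factor are `±√d_i`. -/
theorem projected_bse_eigendecomposition (k : ℕ) (d : Fin k → ℝ) (hd : ∀ i, 0 < d i) :
    let D : Matrix (Fin k) (Fin k) ℂ := Matrix.diagonal (fun i => (d i : ℂ))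
    let Dhalf : Matrix (Fin k) (Fin k) ℂ := Matrix.diagonal (fun i => (Real.sqrt (d i) : ℂ))
    let Gt : Matrix (Fin k ⊕ Fin k) (Fin k ⊕ Fin k) ℂ :=
      Matrix.fromBlocks (Dhalf + 1) (Dhalf - 1) (Dhalf - 1) (Dhalf + 1)
    IsUnit Gt.det ∧
    ((1 : ℂ) / 2) • Matrix.fromBlocks (1 + D) (1 - D) (-(1 - D)) (-(1 + D)) * Gt =
      Gt * Matrix.fromBlocks Dhalf 0 0 (-Dhalf) ∧
    (∀ μ : ℂ, μ ∈ spectrum ℂ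
        (((1 : ℂ) / 2) • Matrix.fromBlocks (1 + D) (1 - D) (-(1 - D)) (-(1 + D)) :
          Matrix (Fin k ⊕ Fin k) (Fin k ⊕ Fin k) ℂ) ↔
      ∃ i, μ = (Real.sqrt (d i) : ℂ) ∨ μ = -(Real.sqrt (d i) : ℂ)) := by
  intro D Dhalf Gt
  have hs : ∀ i, (Real.sqrt (d i) : ℂ) ≠ 0 := fun i => by
    exact_mod_cast (Real.sqrt_pos.2 (hd i)).ne'
  have hD : D = Dhalf * Dhalf := by
    simp only [D, Dhalf, Matrix.diagonal_mul_diagonal]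
    congr 1
    funext i
    exact_mod_cast (Real.mul_self_sqrt (hd i).le).symm
  have hdet : IsUnit Gt.det := by
    have hmul : Gt * Matrix.fromBlocks (Dhalf + 1) (1 - Dhalf) (1 - Dhalf) (Dhalf + 1) =
        Matrix.fromBlocks ((4 : ℂ) • Dhalf) 0 0 ((4 : ℂ) • Dhalf) := by
      simp only [Gt, Matrix.fromBlocks_multiply]
      congr 1 <;> noncomm_ring
      all_goals module
    have hunit : IsUnit ((4 : ℂ) • Dhalf).det := by
      simp [Dhalf, Finset.prod_ne_zero_iff, hs, -Complex.ofReal_eq_zero]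
    have := congrArg Matrix.det hmul
    rw [Matrix.det_mul, Matrix.det_fromBlocks_zero₂₁] at this
    exact isUnit_of_mul_isUnit_left (this ▸ hunit.mul hunit)
  have hmul : ((1 : ℂ) / 2) • Matrix.fromBlocks (1 + D) (1 - D) (-(1 - D)) (-(1 + D)) * Gt =
      Gt * Matrix.fromBlocks Dhalf 0 0 (-Dhalf) := by
    simp only [Gt, hD, Matrix.smul_mul, Matrix.fromBlocks_multiply, Matrix.fromBlocks_smul]
    congr 1 <;> noncomm_ring
    all_goals module
  refine ⟨hdet, hmul, fun μ => ?_⟩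
  have hdiag : Matrix.fromBlocks Dhalf 0 0 (-Dhalf) = Matrix.diagonal
      (Sum.elim (fun i => (Real.sqrt (d i) : ℂ)) (fun i => -(Real.sqrt (d i) : ℂ))) := by
    rw [← Matrix.fromBlocks_diagonal, ← Matrix.diagonal_neg]
  rw [spectrum_eq_range_of_mul_eq_mul_diagonal hdet (hmul.trans (congrArg (Gt * ·) hdiag))]
  simp [Set.mem_range, exists_or, eq_comm]
end

section
/- Let H = [[R, C],[−conj(C), −conj(R)]] be a definite Bethe–Salpeter matrix (so Ĥ = [[R, C],[conj(C), conj(R)]] is positive definite). Then H is invertible and H⁻¹ is again a definite Bethe–Salpeter matrix: there exist R', C' ∈ ℂ^{n×n} with R' = R'* and C' = C'ᵀ such that H⁻¹ = [[R', C'],[−conj(C'), −conj(R')]] and [[R', C'],[conj(C'), conj(R')]] is positive definite. -/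
open Matrix
open scoped ComplexOrder

/-- A Hermitian matrix `[[R, C], [conj C, conj R]]` equals the block swap of its transpose. -/
theorem transpose_submatrix_swap_fromBlocks_mconj {m : Type*} {R C : Matrix m m ℂ}
    (hR : Rᴴ = R) (hC : Cᵀ = C) :
    (fromBlocks R C (mconj C) (mconj R))ᵀ.submatrix (Equiv.sumComm m m) (Equiv.sumComm m m) =
      fromBlocks R C (mconj C) (mconj R) := by
  have hR' (i j : m) : star (R j i) = R i j := congrFun₂ hR i j
  have hC' (i j : m) : C j i = C i j := congrFun₂ hC i j
  ext (i | i) (j | j)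
  · simpa [mconj] using hR' i j
  · simpa using hC' i j
  · simpa [mconj] using congrArg star (hC' i j)
  · simpa [mconj] using (hR' j i).symm

/-- A Hermitian matrix equal to the block swap of its transpose has the form
`[[P, Q], [conj Q, conj P]]` with `P` Hermitian and `Q` symmetric. -/
theorem exists_eq_fromBlocks_mconj {m : Type*} {G : Matrix (m ⊕ m) (m ⊕ m) ℂ}
    (hG : G.IsHermitian)
    (hswap : Gᵀ.submatrix (Equiv.sumComm m m) (Equiv.sumComm m m) = G) :
    ∃ P Q : Matrix m m ℂ, Pᴴ = P ∧ Qᵀ = Q ∧ G = fromBlocks P Q (mconj Q) (mconj P) := by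
  have hs (i j : m ⊕ m) : G j.swap i.swap = G i j := congrFun₂ hswap i j
  refine ⟨G.toBlocks₁₁, G.toBlocks₁₂, ?_, ?_, ?_⟩
  · ext i j
    exact hG.apply (.inl i) (.inl j)
  · ext i j
    exact hs (.inl i) (.inr j)
  · ext (i | i) (j | j)
    · rfl
    · rfl
    · exact (hG.apply (.inr i) (.inl j)).symm.trans
        (congrArg star (hs (.inl j) (.inr i)).symm)
    · exact (hG.apply (.inr i) (.inr j)).symm.trans
        (congrArg star (hs (.inr j) (.inr i)).symm)

/-- The inverse of a definite Bethe–Salpeter matrix is again a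
definite Bethe–Salpeter matrix. -/
theorem bse_inverse_is_bse (n : ℕ) (R C : Matrix (Fin n) (Fin n) ℂ)
    (hR : Rᴴ = R) (hC : Cᵀ = C)
    (hdef : (Matrix.fromBlocks R C (mconj C) (mconj R)).PosDef) :
    let H : Matrix (Fin n ⊕ Fin n) (Fin n ⊕ Fin n) ℂ :=
      Matrix.fromBlocks R C (-(mconj C)) (-(mconj R))
    IsUnit H.det ∧
    ∃ R' C' : Matrix (Fin n) (Fin n) ℂ, R'ᴴ = R' ∧ C'ᵀ = C' ∧
      H⁻¹ = Matrix.fromBlocks R' C' (-(mconj C')) (-(mconj R')) ∧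
      (Matrix.fromBlocks R' C' (mconj C') (mconj R')).PosDef := by
  intro H
  set K := fromBlocks R C (mconj C) (mconj R) with hK
  let S : Matrix (Fin n ⊕ Fin n) (Fin n ⊕ Fin n) ℂ := fromBlocks 1 0 0 (-1)
  have hSS : S * S = 1 := by simp [S, fromBlocks_multiply]
  have hSH : Sᴴ = S := by simp [S, fromBlocks_conjTranspose]
  have hSunit : IsUnit S := IsUnit.of_mul_eq_one S hSS
  have hH : H = S * K := by simp [H, S, hK, fromBlocks_multiply]
  obtain ⟨P, Q, hP, hQ, hKinv⟩ := exists_eq_fromBlocks_mconj hdef.inv.isHermitian (by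
    rw [transpose_nonsing_inv, ← inv_submatrix_equiv,
      transpose_submatrix_swap_fromBlocks_mconj hR hC])
  have hneg : mconj (-Q) = -mconj Q := by ext; simp [mconj]
  refine ⟨?_, P, -Q, hP, by rw [transpose_neg, hQ], ?_, ?_⟩
  · rw [hH, ← isUnit_iff_isUnit_det]
    exact hSunit.mul hdef.isUnit
  · rw [hH, Matrix.mul_inv_rev, inv_eq_right_inv hSS, hKinv, hneg]
    simp [S, fromBlocks_multiply]
  · have h := (hSunit.posDef_star_left_conjugate_iff).mpr hdef.inv
    rw [star_eq_conjTranspose, hSH, hKinv] at h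
    simpa [S, fromBlocks_multiply, hneg] using h
end
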